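/- Suppose 1/4 < a ≤ 1/3 and m ≥ 6. Then there exists h ∈ ℕ with ⌊2(m+1)/3⌋ + 1 ≤ h − 1 < h ≤ m + 1 such that (h−1)π/(m+1) < arccos(−1/(2√a)) ≤ hπ/(m+1). Moreover, provided arccos(−1/(2√a)) ≠ hπ/(m+1), the function g_m(θ) = (ζ(θ) − cos θ)·sin((m+1)θ)/sin θ − cos((m+1)θ) + 1/ζ(θ)^{m+1} has at least two zeros on the open interval ((h−1)π/(m+1), hπ/(m+1)) when h ≤ m, and at least one zero on that interval when h = m + 1. -/

import Mathlib

/-- `ζ(θ)` from the paper. -/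
noncomputable def zetaFn (a θ : ℝ) : ℝ :=
  ((2 * a - 1) * Real.cos θ + Real.sqrt ((1 - 4 * a) * Real.cos θ ^ 2 + a)) /
    (1 - 4 * a * Real.cos θ ^ 2)

/-- `g_m(θ)` from the paper. -/
noncomputable def gFn (a : ℝ) (m : ℕ) (θ : ℝ) : ℝ :=
  (zetaFn a θ - Real.cos θ) * Real.sin ((m + 1) * θ) / Real.sin θ -
    Real.cos ((m + 1) * θ) + 1 / (zetaFn a θ) ^ (m + 1)

/-- reciprocal of zeta, continuous across the asymptote -/
noncomputable def wFn (a θ : ℝ) : ℝ :=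
  ((1 - 2 * a) * Real.cos θ + Real.sqrt ((1 - 4 * a) * Real.cos θ ^ 2 + a)) / a

/-- regularised g -/
noncomputable def FFn (a : ℝ) (m : ℕ) (θ : ℝ) : ℝ :=
  (1 - Real.cos θ * wFn a θ) * Real.sin ((m + 1) * θ) / Real.sin θ -
    wFn a θ * Real.cos ((m + 1) * θ) + wFn a θ ^ (m + 2)

lemma disc_nonneg (a c : ℝ) (ha1 : 1 / 4 < a) (ha2 : a ≤ 1 / 3) (hc : c ^ 2 ≤ 1) :
    0 ≤ (1 - 4 * a) * c ^ 2 + a := by nlinarith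

lemma w_mul (a θ : ℝ) (ha1 : 1 / 4 < a) (ha2 : a ≤ 1 / 3) :
    wFn a θ * ((2 * a - 1) * Real.cos θ + Real.sqrt ((1 - 4 * a) * Real.cos θ ^ 2 + a)) =
      1 - 4 * a * Real.cos θ ^ 2 := by
  have h := Real.sq_sqrt (disc_nonneg a (Real.cos θ) ha1 ha2 (Real.cos_sq_le_one θ))
  have : a ≠ 0 := by linarith
  unfold wFn
  rw [div_mul_eq_mul_div, div_eq_iff this]
  linear_combination h

lemma N_pos (a θ : ℝ) (ha1 : 1 / 4 < a) (ha2 : a ≤ 1 / 3) (hc : Real.cos θ < 0) :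
    0 < (2 * a - 1) * Real.cos θ + Real.sqrt ((1 - 4 * a) * Real.cos θ ^ 2 + a) := by
  have := Real.sqrt_nonneg ((1 - 4 * a) * Real.cos θ ^ 2 + a)
  nlinarith

lemma zeta_eq (a θ : ℝ) (ha1 : 1 / 4 < a) (ha2 : a ≤ 1 / 3) (hc : Real.cos θ < 0)
    (hw : wFn a θ ≠ 0) : zetaFn a θ = (wFn a θ)⁻¹ := by
  have h1 := w_mul a θ ha1 ha2
  have h2 := N_pos a θ ha1 ha2 hc
  unfold zetaFn
  rw [← h1, div_eq_iff (mul_ne_zero hw h2.ne'), inv_mul_cancel_left₀ hw]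

lemma g_eq (a θ : ℝ) (m : ℕ) (ha1 : 1 / 4 < a) (ha2 : a ≤ 1 / 3) (hc : Real.cos θ < 0)
    (hs : 0 < Real.sin θ) (hw : wFn a θ ≠ 0) (hF : FFn a m θ = 0) : gFn a m θ = 0 := by
  have : wFn a θ * gFn a m θ = FFn a m θ := by
    unfold gFn FFn
    rw [zeta_eq a θ ha1 ha2 hc hw, inv_pow, one_div, inv_inv]
    have := hs.ne'
    field_simp
    ring
  rw [hF] at this
  exact (mul_eq_zero.mp this).resolve_left hw

lemma w_lt_one (a θ : ℝ) (ha1 : 1 / 4 < a) (ha2 : a ≤ 1 / 3) (hc : Real.cos θ < -1 / 2) :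
    wFn a θ < 1 := by
  unfold wFn
  rw [div_lt_one (by linarith)]
  have : Real.sqrt ((1 - 4 * a) * Real.cos θ ^ 2 + a) < a - (1 - 2 * a) * Real.cos θ := by
    set c := Real.cos θ
    rw [Real.sqrt_lt' (by nlinarith)]
    have : 0 < a * ((-1 - 2 * c) * (1 + a * (-1 - 2 * c))) := by
      have : 0 < -1 - 2 * c := by linarith
      have : 0 < 1 + a * (-1 - 2 * c) := by nlinarith
      positivity
    nlinarith
  linarith

lemma neg_one_lt_w (a θ : ℝ) (ha1 : 1 / 4 < a) (ha2 : a ≤ 1 / 3) (hc : Real.cos θ < -1 / 2)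
    (hc1 : -1 < Real.cos θ) : -1 < wFn a θ := by
  unfold wFn
  rw [lt_div_iff₀ (by linarith)]
  have : -a - (1 - 2 * a) * Real.cos θ < Real.sqrt ((1 - 4 * a) * Real.cos θ ^ 2 + a) := by
    set c := Real.cos θ
    apply Real.lt_sqrt_of_sq_lt
    have h1 : (2 * c - 1) * (c + 1) < 0 := by nlinarith
    have h2 : (1 / 3 - a) * (4 * c ^ 2 - 4 * c + 1) ≥ 0 :=
      mul_nonneg (by linarith) (by nlinarith)
    have h3 : 4 * a * c ^ 2 + 2 * (1 - 2 * a) * c + a - 1 < 0 := by nlinarith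
    have : a * (4 * a * c ^ 2 + 2 * (1 - 2 * a) * c + a - 1) < 0 :=
      mul_neg_of_pos_of_neg (by linarith) h3
    nlinarith
  linarith

lemma w_cont (a : ℝ) : Continuous (wFn a) := by
  unfold wFn; fun_prop

lemma F_cont (a : ℝ) (m : ℕ) (s : Set ℝ) (hs : ∀ x ∈ s, Real.sin x ≠ 0) :
    ContinuousOn (FFn a m) s := by
  have := w_cont a
  unfold FFn
  refine ContinuousOn.add (ContinuousOn.sub (ContinuousOn.div ?_ ?_ hs) ?_) ?_ <;> fun_prop

lemma F_node (a : ℝ) (m k : ℕ) :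
    (-1) ^ k * FFn a m (k * Real.pi / (m + 1)) =
      - wFn a (k * Real.pi / (m + 1)) * (1 - (-1) ^ k * wFn a (k * Real.pi / (m + 1)) ^ (m + 1)) := by
  have e : ((m : ℝ) + 1) * (k * Real.pi / (m + 1)) = k * Real.pi := by field_simp
  unfold FFn
  rw [e, Real.sin_nat_mul_pi, Real.cos_nat_mul_pi]
  have : ((-1 : ℝ) ^ k) * (-1) ^ k = 1 := by rw [← mul_pow]; simp
  linear_combination (- wFn a (k * Real.pi / (m + 1))) * this

lemma node_pos (k n : ℕ) (w : ℝ) (h1 : -1 < w) (h2 : w < 1) :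
    0 < 1 - (-1) ^ k * w ^ (n + 1) := by
  have : |(-1) ^ k * w ^ (n + 1)| < 1 := by
    rw [abs_mul, abs_pow, abs_pow, abs_neg, abs_one, one_pow, one_mul]
    exact pow_lt_one₀ (abs_nonneg _) (abs_lt.mpr ⟨h1, h2⟩) (by omega)
  linarith [(abs_lt.mp this).2]

set_option maxHeartbeats 1000000 in
theorem stmt_9 (a : ℝ) (m : ℕ) (ha1 : 1 / 4 < a) (ha2 : a ≤ 1 / 3) (hm : 6 ≤ m) :
    ∃ h : ℕ, 2 * (m + 1) / 3 + 1 ≤ h - 1 ∧ h - 1 < h ∧ h ≤ m + 1 ∧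
      ((h : ℝ) - 1) * Real.pi / (m + 1) < Real.arccos (-1 / (2 * Real.sqrt a)) ∧
      Real.arccos (-1 / (2 * Real.sqrt a)) ≤ (h : ℝ) * Real.pi / (m + 1) ∧
      (Real.arccos (-1 / (2 * Real.sqrt a)) ≠ (h : ℝ) * Real.pi / (m + 1) →
        (h ≤ m → ∃ θ₁ θ₂ : ℝ,
          θ₁ ∈ Set.Ioo (((h : ℝ) - 1) * Real.pi / (m + 1)) ((h : ℝ) * Real.pi / (m + 1)) ∧
          θ₂ ∈ Set.Ioo (((h : ℝ) - 1) * Real.pi / (m + 1)) ((h : ℝ) * Real.pi / (m + 1)) ∧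
          θ₁ ≠ θ₂ ∧ gFn a m θ₁ = 0 ∧ gFn a m θ₂ = 0) ∧
        (h = m + 1 → ∃ θ₁ : ℝ,
          θ₁ ∈ Set.Ioo (((h : ℝ) - 1) * Real.pi / (m + 1)) ((h : ℝ) * Real.pi / (m + 1)) ∧
          gFn a m θ₁ = 0)) := by
  have hpi := Real.pi_pos
  have hm0 : (0 : ℝ) < m + 1 := by positivity
  have ha0 : 0 < a := by linarith
  have hsa : 0 < Real.sqrt a := Real.sqrt_pos.mpr ha0
  have hsa2 : Real.sqrt a ^ 2 = a := Real.sq_sqrt ha0.le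
  set x := -1 / (2 * Real.sqrt a) with hx
  have hx2 : 4 * a * x ^ 2 = 1 := by
    rw [hx, div_pow, mul_pow, hsa2]; field_simp; norm_num
  have hx0 : x < 0 := by rw [hx]; exact div_neg_of_neg_of_pos (by norm_num) (by positivity)
  have hx1 : -1 < x := by
    by_contra hle
    push Not at hle
    have : 1 ≤ x ^ 2 := by nlinarith
    nlinarith
  have hx3 : x ≤ - (Real.sqrt 3 / 2) := by
    have h3 : Real.sqrt 3 ^ 2 = 3 := Real.sq_sqrt (by norm_num)
    have h30 := Real.sqrt_nonneg 3
    have : 3 / 4 ≤ x ^ 2 := by nlinarith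
    nlinarith
  set α := Real.arccos x with hα
  have hcα : Real.cos α = x := Real.cos_arccos hx1.le (by linarith)
  have hα1 : 5 * Real.pi / 6 ≤ α := by
    by_contra hlt
    push Not at hlt
    have := Real.cos_lt_cos_of_nonneg_of_le_pi (Real.arccos_nonneg x) (by linarith) hlt
    have e : Real.cos (5 * Real.pi / 6) = - (Real.sqrt 3 / 2) := by
      rw [← Real.cos_pi_div_six, ← Real.cos_pi_sub]; congr 1; ring
    rw [e, ← hα, hcα] at this
    linarith
  have hα2 : α < Real.pi := by
    refine lt_of_le_of_ne (Real.arccos_le_pi x) fun he => ?_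
    rw [he, Real.cos_pi] at hcα
    linarith
  have ht0 : 0 < α * (m + 1) / Real.pi := by
    have : 0 < α := by linarith
    positivity
  obtain ⟨k, hk⟩ : ∃ k, ⌈α * (m + 1) / Real.pi⌉₊ = k + 1 :=
    Nat.exists_eq_succ_of_ne_zero (Nat.ceil_pos.mpr ht0).ne'
  have hk1 : α * (m + 1) / Real.pi ≤ (k : ℝ) + 1 := by
    have := Nat.le_ceil (α * (m + 1) / Real.pi)
    rw [hk] at this; exact_mod_cast this
  have hk2 : (k : ℝ) < α * (m + 1) / Real.pi := by
    have := Nat.ceil_lt_add_one ht0.le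
    rw [hk] at this; push_cast at this; linarith
  rw [div_le_iff₀ hpi] at hk1
  rw [lt_div_iff₀ hpi] at hk2
  have hkm : k < m + 1 := by
    have : (k : ℝ) * Real.pi < (m + 1) * Real.pi := by nlinarith
    have := lt_of_mul_lt_mul_right this hpi.le
    exact_mod_cast this
  have hk56 : 5 * (m + 1) ≤ 6 * (k + 1) := by
    have : (5 * ((m : ℝ) + 1)) * Real.pi ≤ (6 * (k + 1)) * Real.pi := by nlinarith
    have := le_of_mul_le_mul_right this hpi
    exact_mod_cast this
  have hk23 : 2 * (m + 1) < 3 * k := by omega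
  have hkl : (k : ℝ) * Real.pi / (m + 1) < α := by
    rw [div_lt_iff₀ hm0]; exact hk2
  have hkr : α ≤ ((k + 1 : ℕ) : ℝ) * Real.pi / (m + 1) := by
    rw [le_div_iff₀ hm0]; push_cast; exact hk1
  have hL : 2 * Real.pi / 3 < (k : ℝ) * Real.pi / (m + 1) := by
    rw [lt_div_iff₀ hm0]
    have : (2 : ℝ) * (m + 1) < 3 * k := by exact_mod_cast hk23
    nlinarith
  have hcos : ∀ θ, 2 * Real.pi / 3 < θ → θ ≤ Real.pi → Real.cos θ < -1 / 2 := by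
    intro θ h1 h2
    have := Real.cos_lt_cos_of_nonneg_of_le_pi (by positivity) h2 h1
    have e : Real.cos (2 * Real.pi / 3) = -1 / 2 := by
      rw [show 2 * Real.pi / 3 = Real.pi - Real.pi / 3 by ring, Real.cos_pi_sub,
        Real.cos_pi_div_three]; norm_num
    linarith
  have hsin : ∀ θ, 2 * Real.pi / 3 < θ → θ < Real.pi → 0 < Real.sin θ := fun θ h1 h2 =>
    Real.sin_pos_of_pos_of_lt_pi (by linarith) h2
  have hwpos : ∀ θ, 2 * Real.pi / 3 < θ → θ < α → 0 < wFn a θ := by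
    intro θ h1 h2
    have hc := hcos θ h1 (by linarith)
    have h3 := Real.cos_lt_cos_of_nonneg_of_le_pi (by linarith) hα2.le h2
    rw [hcα] at h3
    refine pos_of_mul_pos_left ?_ (N_pos a θ ha1 ha2 (by linarith)).le
    rw [w_mul a θ ha1 ha2, ← hx2]
    have : Real.cos θ ^ 2 < x ^ 2 := by nlinarith
    nlinarith
  have hwneg : ∀ θ, α < θ → θ ≤ Real.pi → wFn a θ < 0 := by
    intro θ h1 h2
    have hc := hcos θ (by linarith) h2
    have h3 := Real.cos_lt_cos_of_nonneg_of_le_pi (by linarith) h2 h1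
    rw [hcα] at h3
    refine neg_of_mul_neg_left ?_ (N_pos a θ ha1 ha2 (by linarith)).le
    rw [w_mul a θ ha1 ha2, ← hx2]
    have : x ^ 2 < Real.cos θ ^ 2 := by nlinarith
    nlinarith
  have hwα : wFn a α = 0 := by
    have h1 := w_mul a α ha1 ha2
    rw [hcα, hx2, sub_self] at h1
    have := N_pos a α ha1 ha2 (by rw [hcα]; exact hx0)
    rw [hcα] at this
    exact (mul_eq_zero.mp h1).resolve_right this.ne'
  have hlH : (-1) ^ k * FFn a m (k * Real.pi / (m + 1)) < 0 := by
    rw [F_node]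
    have h1 := hwpos _ hL hkl
    have h2 := node_pos k m _ (by linarith) (w_lt_one a _ ha1 ha2 (hcos _ hL (by linarith)))
    nlinarith
  refine ⟨k + 1, by omega, by omega, by omega, ?_, hkr, ?_⟩
  · push_cast; rw [add_sub_cancel_right]; exact hkl
  intro hne
  have hkr' := lt_of_le_of_ne hkr hne
  have hαH : 0 < (-1) ^ k * FFn a m α := by
    have e : (-1) ^ k * FFn a m α = Real.sin ((m + 1) * α - k * Real.pi) / Real.sin α := by
      rw [Real.sin_sub_nat_mul_pi]
      unfold FFn
      rw [hwα, zero_pow (by omega)]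
      ring
    rw [e]
    refine div_pos (Real.sin_pos_of_pos_of_lt_pi (by linarith) ?_) (hsin α (by linarith) hα2)
    rw [lt_div_iff₀ hm0] at hkr'
    push_cast at hkr'
    linarith
  have hcontH : ∀ s : Set ℝ, (∀ y ∈ s, 2 * Real.pi / 3 < y ∧ y < Real.pi) →
      ContinuousOn (fun y => (-1) ^ k * FFn a m y) s := fun s hs =>
    continuousOn_const.mul (F_cont a m s fun y hy => (hsin y (hs y hy).1 (hs y hy).2).ne')
  have hk1ne : ((-1 : ℝ)) ^ k ≠ 0 := pow_ne_zero _ (by norm_num)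
  have hcast : (((k + 1 : ℕ) : ℝ) - 1) = k := by push_cast; ring
  rw [hcast]
  have left : ∃ θ, θ ∈ Set.Ioo ((k : ℝ) * Real.pi / (m + 1)) α ∧ gFn a m θ = 0 := by
    obtain ⟨θ, hθ, h0⟩ := intermediate_value_Ioo hkl.le
      (hcontH (Set.Icc _ _) fun y hy => ⟨by linarith [hy.1], by linarith [hy.2]⟩)
      (show (0 : ℝ) ∈ Set.Ioo _ _ from ⟨hlH, hαH⟩)
    have hθ1 : 2 * Real.pi / 3 < θ := by linarith [hθ.1]
    have hθ2 : θ < Real.pi := by linarith [hθ.2]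
    exact ⟨θ, hθ, g_eq a θ m ha1 ha2 (by linarith [hcos θ hθ1 hθ2.le]) (hsin θ hθ1 hθ2)
      (hwpos θ hθ1 hθ.2).ne' ((mul_eq_zero.mp h0).resolve_left hk1ne)⟩
  obtain ⟨θ₁, hθ₁, h₁⟩ := left
  refine ⟨fun hh => ?_, fun _ => ⟨θ₁, ⟨hθ₁.1, hθ₁.2.trans hkr'⟩, h₁⟩⟩
  have hR : ((k + 1 : ℕ) : ℝ) * Real.pi / (m + 1) < Real.pi := by
    rw [div_lt_iff₀ hm0]
    have : ((k + 1 : ℕ) : ℝ) ≤ m := by exact_mod_cast hh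
    nlinarith
  have hrH : (-1) ^ k * FFn a m (((k + 1 : ℕ) : ℝ) * Real.pi / (m + 1)) < 0 := by
    have h0 := F_node a m (k + 1)
    have h1 := hwneg _ hkr' hR.le
    have hc1 := Real.cos_lt_cos_of_nonneg_of_le_pi (by linarith) le_rfl hR
    rw [Real.cos_pi] at hc1
    have h2 := node_pos (k + 1) m _
      (neg_one_lt_w a _ ha1 ha2 (hcos _ (by linarith) hR.le) hc1) (by linarith)
    have h3 := mul_pos (neg_pos.mpr h1) h2
    rw [← h0, pow_succ] at h3
    linarith
  obtain ⟨θ₂, hθ₂, h0⟩ := intermediate_value_Ioo' hkr'.le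
      (hcontH (Set.Icc _ _) fun y hy => ⟨by linarith [hy.1], by linarith [hy.2]⟩)
      (show (0 : ℝ) ∈ Set.Ioo _ _ from ⟨hrH, hαH⟩)
  have hθ1 : 2 * Real.pi / 3 < θ₂ := by linarith [hθ₂.1]
  have hθ2 : θ₂ < Real.pi := by linarith [hθ₂.2]
  exact ⟨θ₁, θ₂, ⟨hθ₁.1, hθ₁.2.trans hkr'⟩, ⟨hkl.trans hθ₂.1, hθ₂.2⟩,
    (hθ₁.2.trans hθ₂.1).ne, h₁, g_eq a θ₂ m ha1 ha2 (by linarith [hcos θ₂ hθ1 hθ2.le])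
      (hsin θ₂ hθ1 hθ2) (hwneg θ₂ hθ₂.1 hθ2.le).ne ((mul_eq_zero.mp h0).resolve_left hk1ne)⟩
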